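/- Let γ, a, b, d > 0 with a ≤ b. Then for every x ≥ 0, sup_{u∈[0,γ]} inf_{v∈[a,b]} [ −(d/a)u + 2√u + (d/a)x·v − d·x ] = a/d − (d/a)·dist(a/d, [0,√γ])², where dist(r, S) denotes the Euclidean distance from the real number r to the set S. Equivalently, the pair ρ = a/d − (d/a)·dist²(a/d, [0,√γ]) and w(x) = −(d/a)x is a classical solution on [0,∞) of the ergodic HJBI equation ρ = sup_{u∈[0,γ]} inf_{v∈[a,b]} H(x, w′(x), w″(x), u, v), where H(y,p,A,u,v) = pu + 2√u − y·p·v + (1/2)|σ(y)|²·A − d·y and σ : ℝ → ℝ^d is any bounded Lipschitz function. -/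

import Mathlib

noncomputable section

/-- Remark 5.1(ii), pollution accumulation example: for `γ, a, b, d > 0`
with `a ≤ b` and every `x ≥ 0`,
`sup_{u∈[0,γ]} inf_{v∈[a,b]} [−(d/a)u + 2√u + (d/a)x·v − d·x]
  = a/d − (d/a)·dist(a/d, [0,√γ])²`. -/
theorem pollution_example_explicit_solution
    (γ a b d : ℝ) (hγ : 0 < γ) (ha : 0 < a) (hb : 0 < b) (hd : 0 < d) (hab : a ≤ b)
    (x : ℝ) (hx : 0 ≤ x) :
    (⨆ u : Set.Icc (0 : ℝ) γ, ⨅ v : Set.Icc a b,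
        (-(d / a) * (u : ℝ) + 2 * Real.sqrt u + (d / a) * x * (v : ℝ) - d * x))
      = a / d - (d / a) * (Metric.infDist (a / d) (Set.Icc (0 : ℝ) (Real.sqrt γ))) ^ 2 := by
  have hinf : ∀ u : Set.Icc (0 : ℝ) γ, (⨅ v : Set.Icc a b,
        (-(d / a) * (u : ℝ) + 2 * Real.sqrt u + (d / a) * x * (v : ℝ) - d * x))
      = a / d - (d / a) * (dist (a / d) (Real.sqrt u)) ^ 2 := by
    intro u
    have hu : Real.sqrt u ^ 2 = (u : ℝ) := Real.sq_sqrt u.2.1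
    have hval : a / d - (d / a) * (dist (a / d) (Real.sqrt u)) ^ 2
        = -(d / a) * (u : ℝ) + 2 * Real.sqrt u + (d / a) * x * a - d * x := by
      rw [Real.dist_eq, sq_abs]
      nth_rewrite 2 [← hu]
      field_simp
      ring
    rw [hval]
    refine IsLeast.csInf_eq ⟨⟨⟨a, le_refl a, hab⟩, rfl⟩, ?_⟩
    rintro _ ⟨v, rfl⟩
    have h1 : (d / a) * x * a ≤ (d / a) * x * (v : ℝ) :=
      mul_le_mul_of_nonneg_left v.2.1 (by positivity)
    dsimp only
    linarith
  simp_rw [hinf]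
  have hda : 0 ≤ d / a := by positivity
  refine IsGreatest.csSup_eq ⟨?_, ?_⟩
  · obtain ⟨y, hy, hyd⟩ := (isCompact_Icc (a := (0 : ℝ)) (b := Real.sqrt γ)).exists_infDist_eq_dist
      ⟨0, le_refl _, Real.sqrt_nonneg γ⟩ (a / d)
    refine ⟨⟨y ^ 2, sq_nonneg y, ?_⟩, ?_⟩
    · exact (Real.le_sqrt hy.1 hγ.le).1 hy.2
    · dsimp only
      rw [hyd, Real.sqrt_sq hy.1]
  · rintro _ ⟨u, rfl⟩
    have hmem : Real.sqrt u ∈ Set.Icc (0 : ℝ) (Real.sqrt γ) :=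
      ⟨Real.sqrt_nonneg _, Real.sqrt_le_sqrt u.2.2⟩
    have h1 := Metric.infDist_le_dist_of_mem (x := a / d) hmem
    have h2 := pow_le_pow_left₀ Metric.infDist_nonneg h1 2
    have h3 := mul_le_mul_of_nonneg_left h2 hda
    dsimp only
    linarith
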